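/- arXiv:2010.01511 — 3 statements merged into one kernel-verified Lean document; each statement's English description precedes it below -/
import Mathlib

section
/- The constants c_m satisfy c_m < 1/(m + 1/2) for all integers m ≥ 1. Concretely: (i) (√5 − 1)/2 < 2/3; (ii) the polynomial x⁴ − 3x³ + x² − 2x − 1 has a complex root z with |z| < 2/5; and (iii) for every integer m ≥ 3, (m + 1 − √(m² + 2m − 3))/2 < 2/(2m+1). -/
/-- The quartic changes sign on `[-2/5, 0]`, so it has a real root of absolute value below `2/5`. -/
theorem exists_quartic_root_norm_lt :
    ∃ z : ℂ, z ^ 4 - 3 * z ^ 3 + z ^ 2 - 2 * z - 1 = 0 ∧ ‖z‖ < 2 / 5 := by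
  have hcont : ContinuousOn (fun x : ℝ => x ^ 4 - 3 * x ^ 3 + x ^ 2 - 2 * x - 1)
      (Set.Icc (-(2 / 5)) 0) := by fun_prop
  obtain ⟨x, ⟨hx₁, hx₂⟩, hx⟩ := intermediate_value_Ioo' (by norm_num) hcont
    (show (0 : ℝ) ∈ Set.Ioo _ _ by constructor <;> norm_num)
  refine ⟨x, by exact_mod_cast hx, ?_⟩
  rw [Complex.norm_real, Real.norm_eq_abs, abs_lt]
  constructor <;> linarith

theorem add_one_sub_sqrt_div_two_lt {x : ℝ} (hx : 3 / 2 < x) :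
    (x + 1 - Real.sqrt (x ^ 2 + 2 * x - 3)) / 2 < 2 / (2 * x + 1) := by
  have hpos : 0 < 2 * x + 1 := by linarith
  have hsqrt : x + 1 - 4 / (2 * x + 1) < Real.sqrt (x ^ 2 + 2 * x - 3) := by
    apply Real.lt_sqrt_of_sq_lt
    have hdiff : x ^ 2 + 2 * x - 3 - (x + 1 - 4 / (2 * x + 1)) ^ 2
        = (8 * x - 12) / (2 * x + 1) ^ 2 := by
      field_simp
      ring
    have : 0 < (8 * x - 12) / (2 * x + 1) ^ 2 := div_pos (by linarith) (by positivity)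
    linarith
  have hhalf : 2 / (2 * x + 1) = 4 / (2 * x + 1) / 2 := by ring
  linarith

theorem stmt_2 :
    (Real.sqrt 5 - 1) / 2 < 2 / 3 ∧
    (∃ z : ℂ, z ^ 4 - 3 * z ^ 3 + z ^ 2 - 2 * z - 1 = 0 ∧ ‖z‖ < 2 / 5) ∧
    (∀ m : ℕ, 3 ≤ m →
      ((m : ℝ) + 1 - Real.sqrt ((m : ℝ) ^ 2 + 2 * (m : ℝ) - 3)) / 2
        < 2 / (2 * (m : ℝ) + 1)) := by
  refine ⟨?_, exists_quartic_root_norm_lt, fun m hm => add_one_sub_sqrt_div_two_lt ?_⟩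
  · have : Real.sqrt 5 < 7 / 3 := by
      rw [Real.sqrt_lt' (by norm_num)]
      norm_num
    linarith
  · have : (3 : ℝ) ≤ m := by exact_mod_cast hm
    linarith
end

section
/- Let f and g be polynomials with complex coefficients, and let (q_n) be a sequence of complex numbers with f(q_n)·q_nⁿ + g(q_n) = 0 for all n. If q_n → q as n → ∞ and |q| > 1, then f(q) = 0. -/
open Filter in
/-- If `u n` converges to a point of the open unit ball, then `u n ^ n` tends to zero. -/
lemma tendsto_pow_self_index_zero {u : ℕ → ℂ} {a : ℂ} (hu : Tendsto u atTop (nhds a))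
    (ha : ‖a‖ < 1) : Tendsto (fun n => u n ^ n) atTop (nhds 0) := by
  obtain ⟨r, har, hr1⟩ := exists_between ha
  have hr0 : 0 ≤ r := (norm_nonneg a).trans har.le
  refine squeeze_zero_norm' ?_ (tendsto_pow_atTop_nhds_zero_of_lt_one hr0 hr1)
  filter_upwards [hu.norm.eventually_lt_const har] with n hn
  rw [norm_pow]
  gcongr

theorem stmt_10 (f g : Polynomial ℂ) (s : ℕ → ℂ)
    (hroot : ∀ n : ℕ, f.eval (s n) * (s n) ^ n + g.eval (s n) = 0)
    (q : ℂ) (hlim : Filter.Tendsto s Filter.atTop (nhds q))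
    (hq : 1 < ‖q‖) :
    f.eval q = 0 := by
  have hq0 : q ≠ 0 := norm_pos_iff.mp (zero_lt_one.trans hq)
  have hinv : ‖q⁻¹‖ < 1 := by
    rw [norm_inv]
    exact inv_lt_one_of_one_lt₀ hq
  have hpow := tendsto_pow_self_index_zero (hlim.inv₀ hq0) hinv
  have hf := (f.continuous.tendsto q).comp hlim
  have hg := ((g.continuous.tendsto q).comp hlim).neg.mul hpow
  rw [mul_zero] at hg
  refine tendsto_nhds_unique hf (hg.congr' ?_)
  filter_upwards [hlim.eventually_ne hq0] with n hn
  have hsn : s n ^ n ≠ 0 := pow_ne_zero n hn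
  simp only [Function.comp_apply, inv_pow]
  rw [← div_eq_mul_inv, div_eq_iff hsn]
  linear_combination -hroot n
end

section
/- Let f and g be polynomials with complex coefficients with g ≠ 0, and let q ∈ ℂ with |q| < 1 and g(q) = 0. Then there exist N ∈ ℕ and complex numbers q_n for n ≥ N such that f(q_n)·q_nⁿ + g(q_n) = 0 for every n ≥ N and q_n → q as n → ∞. -/
open Filter Metric Topology

/-- Minimum modulus principle on a disk: a holomorphic function that is smaller at the centre than
on the bounding circle has a zero in the closed disk. -/
lemma Complex.exists_mem_closedBall_eq_zero_of_norm_lt {F : ℂ → ℂ} (hF : Differentiable ℂ F)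
    {q : ℂ} {r c : ℝ} (hr : 0 < r) (hq : ‖F q‖ < c) (hc : ∀ z ∈ sphere q r, c ≤ ‖F z‖) :
    ∃ z ∈ closedBall q r, F z = 0 := by
  by_contra! h
  have hFq : 0 < ‖F q‖ := norm_pos_iff.2 (h q (mem_closedBall_self hr.le))
  have hd : DiffContOnCl ℂ (fun z => (F z)⁻¹) (ball q r) := by
    refine hF.diffContOnCl.inv fun z hz => ?_
    rw [closure_ball q hr.ne'] at hz
    exact h z hz
  have hle : ‖(F q)⁻¹‖ ≤ c⁻¹ := by
    refine Complex.norm_le_of_forall_mem_frontier_norm_le isBounded_ball hd (fun z hz => ?_)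
      (subset_closure (mem_ball_self hr))
    rw [frontier_ball q hr.ne'] at hz
    rw [norm_inv]
    exact inv_anti₀ (hFq.trans hq) (hc z hz)
  rw [norm_inv] at hle
  exact absurd ((inv_le_inv₀ hFq (hFq.trans hq)).1 hle) (not_le.2 hq)

/-- If closed sets `S n` in a proper metric space eventually meet every closed ball around `q`,
then there is a sequence converging to `q` whose terms eventually lie in `S n`. -/
lemma exists_tendsto_of_eventually_exists_mem_closedBall {X : Type*} [MetricSpace X]
    [ProperSpace X] {S : ℕ → Set X} (hS : ∀ n, IsClosed (S n)) {q : X}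
    (h : ∀ ε > 0, ∀ᶠ n in atTop, ∃ z ∈ closedBall q ε, z ∈ S n) :
    ∃ s : ℕ → X, (∀ᶠ n in atTop, s n ∈ S n) ∧ Tendsto s atTop (𝓝 q) := by
  have hex : ∀ n, ∃ z, (S n).Nonempty → z ∈ S n ∧ infDist q (S n) = dist q z := by
    intro n
    by_cases hne : (S n).Nonempty
    · obtain ⟨z, hz, hzd⟩ := (hS n).exists_infDist_eq_dist hne q
      exact ⟨z, fun _ => ⟨hz, hzd⟩⟩
    · exact ⟨q, fun hne' => absurd hne' hne⟩
  choose s hs using hex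
  refine ⟨s, ?_, Metric.tendsto_nhds.2 fun ε hε => ?_⟩
  · filter_upwards [h 1 one_pos] with n ⟨z, _, hz⟩
    exact (hs n ⟨z, hz⟩).1
  · filter_upwards [h (ε / 2) (half_pos hε)] with n ⟨z, hzb, hz⟩
    have hle := infDist_le_dist_of_mem (x := q) hz
    rw [(hs n ⟨z, hz⟩).2, dist_comm q, dist_comm q] at hle
    rw [mem_closedBall] at hzb
    linarith

/-- Every closed disk around a root `q` of `g` with `‖q‖ < 1` eventually contains a root of
`f(x) xⁿ + g(x)`. -/
lemma Polynomial.eventually_exists_mem_closedBall_eval_mul_pow_add_eq_zero (f : Polynomial ℂ)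
    {g : Polynomial ℂ} (hg : g ≠ 0) {q : ℂ} (hq : ‖q‖ < 1) (hroot : g.eval q = 0)
    {ε : ℝ} (hε : 0 < ε) :
    ∀ᶠ n : ℕ in atTop, ∃ z ∈ closedBall q ε, f.eval z * z ^ n + g.eval z = 0 := by
  obtain ⟨δ, hδ, hgδ⟩ : ∃ δ > 0, ∀ z, dist z q < δ → z ≠ q → g.eval z ≠ 0 := by
    have hfin : ((g.roots.toFinset : Set ℂ) \ {q}).Finite := (Finset.finite_toSet _).sdiff
    obtain ⟨δ, hδ, hsub⟩ := Metric.mem_nhds_iff.1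
      (hfin.isClosed.isOpen_compl.mem_nhds (x := q) (by simp))
    refine ⟨δ, hδ, fun z hz hzq hgz => hsub (mem_ball.2 hz) ⟨?_, hzq⟩⟩
    simpa [hg] using hgz
  obtain ⟨r, hr, hrε, hrδ, hr1⟩ : ∃ r > 0, r ≤ ε ∧ r < δ ∧ ‖q‖ + r < 1 := by
    obtain ⟨r, hr, hlt⟩ := exists_between (lt_min hε (lt_min hδ (sub_pos.2 hq)))
    simp only [lt_min_iff] at hlt
    exact ⟨r, hr, hlt.1.le, hlt.2.1, by linarith⟩
  obtain ⟨w, hw, hmin⟩ := (isCompact_sphere q r).exists_isMinOn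
    (NormedSpace.sphere_nonempty.2 hr.le) (g.continuous.norm.continuousOn)
  have hm : 0 < ‖g.eval w‖ :=
    norm_pos_iff.2 (hgδ w (by rwa [mem_sphere.1 hw]) (ne_of_mem_sphere hw hr.ne'))
  obtain ⟨M, hM⟩ := (isCompact_closedBall q r).exists_bound_of_continuousOn
    (f.continuous.continuousOn)
  have hlim : Tendsto (fun n : ℕ => M * (‖q‖ + r) ^ n) atTop (𝓝 0) := by
    simpa using (tendsto_pow_atTop_nhds_zero_of_lt_one (by positivity) hr1).const_mul M
  filter_upwards [hlim.eventually_lt_const (half_pos hm)] with n hn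
  have hsmall : ∀ z ∈ closedBall q r, ‖f.eval z * z ^ n‖ < ‖g.eval w‖ / 2 := by
    intro z hz
    refine lt_of_le_of_lt ?_ hn
    have hzn : ‖z‖ ≤ ‖q‖ + r := norm_le_of_mem_closedBall hz
    rw [norm_mul, norm_pow]
    exact mul_le_mul (hM z hz) (pow_le_pow_left₀ (norm_nonneg z) hzn n) (by positivity)
      ((norm_nonneg _).trans (hM z hz))
  obtain ⟨z, hz, hz0⟩ := Complex.exists_mem_closedBall_eq_zero_of_norm_lt
    (F := fun z => f.eval z * z ^ n + g.eval z) (q := q) (c := ‖g.eval w‖ / 2)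
    ((f.differentiable.mul (differentiable_id.pow n)).add g.differentiable) hr
    (by simpa only [hroot, add_zero] using hsmall q (mem_closedBall_self hr.le))
    (fun z hz => by
      have hsum := norm_sub_le (f.eval z * z ^ n + g.eval z) (f.eval z * z ^ n)
      rw [add_sub_cancel_left] at hsum
      have hgz : ‖g.eval w‖ ≤ ‖g.eval z‖ := hmin hz
      linarith [hsmall z (sphere_subset_closedBall hz)])
  exact ⟨z, closedBall_subset_closedBall hrε hz, hz0⟩

theorem stmt_11 (f g : Polynomial ℂ) (hg : g ≠ 0) (q : ℂ)
    (hq : ‖q‖ < 1) (hroot : g.eval q = 0) :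
    ∃ (N : ℕ) (s : ℕ → ℂ),
      (∀ n : ℕ, N ≤ n → f.eval (s n) * (s n) ^ n + g.eval (s n) = 0) ∧
      Filter.Tendsto s Filter.atTop (nhds q) := by
  obtain ⟨s, hs, hlim⟩ := exists_tendsto_of_eventually_exists_mem_closedBall
    (S := fun n => {z : ℂ | f.eval z * z ^ n + g.eval z = 0})
    (fun n => isClosed_eq (by fun_prop) continuous_const)
    (fun _ hε => f.eventually_exists_mem_closedBall_eval_mul_pow_add_eq_zero hg hq hroot hε)
  obtain ⟨N, hN⟩ := eventually_atTop.1 hs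
  exact ⟨N, s, hN, hlim⟩
end
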